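/- arXiv:1902.07064 — 2 statements merged into one kernel-verified Lean document; each statement's English description precedes it below -/
import Mathlib

section
/- Let ρ > 0 and α ∈ ℝ. Then ∫₀^∞ (1 + ρz)^α·(1 − (1+ρz)^{−2})·e^{−z} dz = e^{1/ρ}·ρ^α·( Γ(α+1, 1/ρ) − (1/ρ²)·Γ(α−1, 1/ρ) ), where Γ(s,x) = ∫_x^∞ t^{s−1} e^{−t} dt is the upper incomplete gamma function. -/
open MeasureTheory Set Real

/-- The upper incomplete gamma function `Γ(s,x) = ∫_x^∞ t^{s−1} e^{−t} dt`. -/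
noncomputable def upperGamma (s x : ℝ) : ℝ :=
  ∫ t in Set.Ioi x, t ^ (s - 1) * Real.exp (-t)

/-- The integrand of the upper incomplete gamma function is integrable away from the origin,
for every real exponent. -/
lemma integrableOn_rpow_mul_exp_neg_Ioi (s : ℝ) {x : ℝ} (hx : 0 < x) :
    IntegrableOn (fun t : ℝ ↦ t ^ s * Real.exp (-t)) (Ioi x) := by
  refine integrable_of_isBigO_exp_neg (b := 1 / 2) (by norm_num) ?_ ?_
  · exact (continuousOn_id.rpow_const fun t ht ↦ .inl (hx.trans_le ht).ne').mul
      (by fun_prop)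
  · simpa only [mul_comm] using (Real.Gamma_integrand_isLittleO s).isBigO

/-- Translation of the domain of integration. -/
lemma setIntegral_Ioi_zero_comp_add_right (f : ℝ → ℝ) (c : ℝ) :
    ∫ z in Ioi (0 : ℝ), f (z + c) = ∫ t in Ioi c, f t := by
  simpa using (measurePreserving_add_right volume c).setIntegral_preimage_emb
    (measurableEmbedding_addRight c) f (Ioi c)

/-- for `ρ > 0` and real `α`,
`∫₀^∞ (1+ρz)^α (1 − (1+ρz)^{−2}) e^{−z} dz
  = e^{1/ρ} ρ^α (Γ(α+1,1/ρ) − (1/ρ²) Γ(α−1,1/ρ))`. -/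
theorem third_integral_eval (ρ α : ℝ) (hρ : 0 < ρ) :
    ∫ z in Set.Ioi (0:ℝ),
        (1 + ρ * z) ^ α * (1 - (1 + ρ * z) ^ (-2 : ℝ)) * Real.exp (-z) =
      Real.exp (1 / ρ) * ρ ^ α *
        (upperGamma (α + 1) (1 / ρ) - 1 / ρ ^ 2 * upperGamma (α - 1) (1 / ρ)) := by
  have hc : 0 < 1 / ρ := by positivity
  unfold upperGamma
  rw [← integral_const_mul,
    ← integral_sub (integrableOn_rpow_mul_exp_neg_Ioi _ hc)
      ((integrableOn_rpow_mul_exp_neg_Ioi _ hc).const_mul _),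
    ← integral_const_mul,
    ← setIntegral_Ioi_zero_comp_add_right _ (1 / ρ)]
  refine setIntegral_congr_fun measurableSet_Ioi fun z (hz : 0 < z) ↦ ?_
  have ht : 0 < z + 1 / ρ := by positivity
  have h1 : 1 + ρ * z = ρ * (z + 1 / ρ) := by field_simp; ring
  have h2 : Real.exp (-z) = Real.exp (1 / ρ) * Real.exp (-(z + 1 / ρ)) := by
    rw [← Real.exp_add]; congr 1; ring
  have h3 : (z + 1 / ρ) ^ (α - 1 - 1) = (z + 1 / ρ) ^ α / (z + 1 / ρ) ^ 2 := by
    rw [← Real.rpow_natCast, ← Real.rpow_sub ht]; congr 1; push_cast; ring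
  have h4 : (ρ * (z + 1 / ρ)) ^ (-2 : ℝ) = (ρ ^ 2 * (z + 1 / ρ) ^ 2)⁻¹ := by
    rw [Real.rpow_neg (by positivity), Real.rpow_two, mul_pow]
  simp only [h1, h2, h3, h4, Real.mul_rpow hρ.le ht.le, add_sub_cancel_right]
  generalize z + 1 / ρ = t at *
  field_simp
end

section
/- Let α < −1 and β ∈ ℝ, and set κ = β²/2 + β. For ρ > 0 define 𝒥(ρ) = e^{1/ρ}·ρ^α·[ (κ+1)·Γ(α+1, 1/ρ) − ((κ − β/2)/ρ²)·Γ(α−1, 1/ρ) ], where Γ(s,x) = ∫_x^∞ t^{s−1} e^{−t} dt. Then lim_{ρ→∞} ρ·𝒥(ρ) = (κ − β/2)/(α − 1) − (κ + 1)/(α + 1). -/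
open MeasureTheory Set Real Filter

/-- The substitution `t = x u` in the upper incomplete gamma integral. -/
theorem upperGamma_eq_rpow_mul_integral (s : ℝ) {x : ℝ} (hx : 0 < x) :
    upperGamma s x = x ^ s * ∫ u in Ioi (1 : ℝ), u ^ (s - 1) * Real.exp (-(x * u)) := by
  have h := integral_comp_mul_left_Ioi (fun t : ℝ => t ^ (s - 1) * Real.exp (-t)) 1 hx
  have hcongr : ∫ u in Ioi (1 : ℝ), (x * u) ^ (s - 1) * Real.exp (-(x * u)) =
      x ^ (s - 1) * ∫ u in Ioi (1 : ℝ), u ^ (s - 1) * Real.exp (-(x * u)) := by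
    rw [← integral_const_mul]
    refine setIntegral_congr_fun measurableSet_Ioi fun u hu => ?_
    have hu' : (0 : ℝ) ≤ u := zero_le_one.trans (le_of_lt hu)
    simp only [Real.mul_rpow hx.le hu', mul_assoc]
  rw [hcongr, mul_one, smul_eq_mul, Real.rpow_sub_one hx.ne'] at h
  unfold upperGamma
  field_simp at h
  exact h.symm

/-- For `s < 0`, `Γ(s, x)` is asymptotic to `-x ^ s / s` as `x → 0⁺`. -/
theorem tendsto_rpow_mul_upperGamma_one_div {s : ℝ} (hs : s < 0) :
    Tendsto (fun ρ : ℝ => ρ ^ s * upperGamma s (1 / ρ)) atTop (nhds (-1 / s)) := by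
  have hlim : Tendsto (fun ρ : ℝ => ∫ u in Ioi (1 : ℝ), u ^ (s - 1) * Real.exp (-(1 / ρ * u)))
      atTop (nhds (∫ u in Ioi (1 : ℝ), u ^ (s - 1))) := by
    refine tendsto_integral_filter_of_dominated_convergence (fun u => u ^ (s - 1)) ?_ ?_
      (integrableOn_Ioi_rpow_of_lt (by linarith) zero_lt_one) ?_
    · exact Eventually.of_forall fun ρ => by
        apply Measurable.aestronglyMeasurable
        fun_prop
    · filter_upwards [eventually_gt_atTop 0] with ρ hρ
      filter_upwards [ae_restrict_mem measurableSet_Ioi] with u hu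
      have hu' : (0 : ℝ) < u := zero_lt_one.trans hu
      rw [Real.norm_of_nonneg (by positivity)]
      refine mul_le_of_le_one_right (by positivity) (Real.exp_le_one_iff.mpr ?_)
      have : 0 ≤ 1 / ρ * u := by positivity
      linarith
    · refine Eventually.of_forall fun u => ?_
      have h0 : Tendsto (fun ρ : ℝ => -(1 / ρ * u)) atTop (nhds 0) := by
        simpa using (tendsto_inv_atTop_zero.mul_const u).neg
      simpa using ((Real.continuous_exp.tendsto 0).comp h0).const_mul (u ^ (s - 1))
  rw [integral_Ioi_rpow_of_lt (by linarith) zero_lt_one, Real.one_rpow, sub_add_cancel] at hlim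
  refine hlim.congr' ?_
  filter_upwards [eventually_gt_atTop 0] with ρ hρ
  rw [upperGamma_eq_rpow_mul_integral s (one_div_pos.mpr hρ), ← mul_assoc,
    ← Real.mul_rpow hρ.le (one_div_pos.mpr hρ).le, mul_one_div_cancel hρ.ne', Real.one_rpow,
    one_mul]

/-- for `α < −1`, `β ∈ ℝ`, `κ = β²/2 + β`, and
`𝒥(ρ) = e^{1/ρ} ρ^α [(κ+1)Γ(α+1,1/ρ) − ((κ−β/2)/ρ²)Γ(α−1,1/ρ)]`, one has
`ρ 𝒥(ρ) → (κ−β/2)/(α−1) − (κ+1)/(α+1)` as `ρ → ∞`. -/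
theorem rho_J_limit (α β κ : ℝ) (hα : α < -1) (hκ : κ = β ^ 2 / 2 + β)
    (J : ℝ → ℝ)
    (hJ : ∀ ρ : ℝ, 0 < ρ →
      J ρ = Real.exp (1 / ρ) * ρ ^ α *
        ((κ + 1) * upperGamma (α + 1) (1 / ρ) -
          (κ - β / 2) / ρ ^ 2 * upperGamma (α - 1) (1 / ρ))) :
    Filter.Tendsto (fun ρ => ρ * J ρ) Filter.atTop
      (nhds ((κ - β / 2) / (α - 1) - (κ + 1) / (α + 1))) := by
  have hexp : Tendsto (fun ρ : ℝ => Real.exp (1 / ρ)) atTop (nhds 1) := by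
    simpa [Function.comp_def] using (Real.continuous_exp.tendsto 0).comp tendsto_inv_atTop_zero
  have hplus := tendsto_rpow_mul_upperGamma_one_div (s := α + 1) (by linarith)
  have hminus := tendsto_rpow_mul_upperGamma_one_div (s := α - 1) (by linarith)
  have hlim := hexp.mul ((hplus.const_mul (κ + 1)).sub (hminus.const_mul (κ - β / 2)))
  have hval : 1 * ((κ + 1) * (-1 / (α + 1)) - (κ - β / 2) * (-1 / (α - 1))) =
      (κ - β / 2) / (α - 1) - (κ + 1) / (α + 1) := by ring
  rw [hval] at hlim
  refine hlim.congr' ?_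
  filter_upwards [eventually_gt_atTop 0] with ρ hρ
  rw [hJ ρ hρ, Real.rpow_add_one hρ.ne', Real.rpow_sub_one hρ.ne']
  field_simp
end
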